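/- For any two positive critical points a < b of F, the absolute values of the corresponding critical values are strictly decreasing: if 0 < a < b, F′(a) = 0 and F′(b) = 0, then |F(a)| > |F(b)| > 0. -/

import Mathlib

theorem crit_aux (F : ℝ → ℝ) (hF : ∀ x, F x = Real.exp (-x ^ 2) * Real.sin x)
    (x : ℝ) (h : deriv F x = 0) : Real.sin x ^ 2 * (1 + 4 * x ^ 2) = 1 := by
  have h1 : HasDerivAt F (Real.exp (-x ^ 2) * (-(2 * x)) * Real.sin x
      + Real.exp (-x ^ 2) * Real.cos x) x := by
    have e : F = fun x => Real.exp (-x ^ 2) * Real.sin x := funext hF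
    rw [e]
    have h2 : HasDerivAt (fun x : ℝ => -x ^ 2) (-(2 * x)) x := by
      simpa using (hasDerivAt_pow 2 x).fun_neg
    exact h2.exp.mul (Real.hasDerivAt_sin x)
  rw [h1.deriv] at h
  have h3 : Real.exp (-x ^ 2) * (Real.cos x - 2 * x * Real.sin x) = 0 := by linarith
  have h4 : Real.cos x = 2 * x * Real.sin x := by
    rcases mul_eq_zero.mp h3 with h | h
    · exact absurd h (Real.exp_pos _).ne'
    · linarith
  have h5 := Real.sin_sq_add_cos_sq x
  rw [h4] at h5
  linarith

/-- For two positive critical points `a < b` of `F x = exp (-x²) * sin x`, the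
corresponding critical values satisfy `|F a| > |F b| > 0`. -/
theorem stmt_8 (F : ℝ → ℝ) (hF : ∀ x, F x = Real.exp (-x ^ 2) * Real.sin x)
    (a b : ℝ) (ha : 0 < a) (hab : a < b)
    (hca : deriv F a = 0) (hcb : deriv F b = 0) :
    0 < |F b| ∧ |F b| < |F a| := by
  have hA := crit_aux F hF a hca
  have hB := crit_aux F hF b hcb
  have hsq : a ^ 2 < b ^ 2 := by nlinarith
  have hb0 : Real.sin b ≠ 0 := by
    intro h
    rw [h] at hB
    norm_num at hB
  have hs : Real.sin b ^ 2 < Real.sin a ^ 2 := by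
    by_contra! hle
    have hp : 0 < Real.sin b ^ 2 := by positivity
    nlinarith [mul_le_mul_of_nonneg_right hle (by positivity : 0 ≤ 1 + 4 * a ^ 2),
      mul_lt_mul_of_pos_left hsq hp]
  have hexp : Real.exp (-b ^ 2) < Real.exp (-a ^ 2) := Real.exp_lt_exp.mpr (by linarith)
  rw [hF, hF, abs_mul, abs_mul, Real.abs_exp, Real.abs_exp]
  have hpos : 0 < |Real.sin b| := abs_pos.mpr hb0
  exact ⟨by positivity, mul_lt_mul hexp (sq_lt_sq.mp hs).le hpos (Real.exp_pos _).le⟩
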